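/- For each i ∈ {1,…,n}, the map α ↦ w_α(i) is continuous on [0,1]; in particular at each breakpoint α_{k+1} the piecewise-linear formulas for the intervals [α_k, α_{k+1}) and [α_{k+1}, α_{k+2}) agree. -/

import Mathlib

/-- The breakpoints `α_k`: `α_0 = 0` and
`α_{k+1} = α_k + (1−α_k)·(p (n−k−1) − p (n−k)) / ((1/(k+1))·∑_{i=1}^{n−k−1} p i + p (n−k−1))`. -/
noncomputable def alphaB (n : ℕ) (p : ℕ → ℝ) : ℕ → ℝ
  | 0 => 0
  | k + 1 =>
      alphaB n p k + (1 - alphaB n p k) * (p (n - k - 1) - p (n - k)) /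
        ((1 / ((k : ℝ) + 1)) * (∑ i ∈ Finset.Icc 1 (n - k - 1), p i) + p (n - k - 1))

/-- The weight vector on the interval `[α_k, α_{k+1})`:
`w_α(i) = (1−α)·p i` for `1 ≤ i ≤ n−k−1` and
`w_α(i) = (α + (1−α)·∑_{j=n−k}^{n} p j)/(k+1)` for `n−k ≤ i ≤ n`. -/
noncomputable def wgt (n k : ℕ) (p : ℕ → ℝ) (α : ℝ) (i : ℕ) : ℝ :=
  if i ≤ n - k - 1 then (1 - α) * p i
  else (α + (1 - α) * ∑ j ∈ Finset.Icc (n - k) n, p j) / ((k : ℝ) + 1)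


open Classical in
/-- The index of the interval `[α_k, α_{k+1})` containing `α`: the greatest
`k ≤ n−1` with `α_k ≤ α`. -/
noncomputable def kIdx (n : ℕ) (p : ℕ → ℝ) (α : ℝ) : ℕ :=
  Nat.findGreatest (fun k => alphaB n p k ≤ α) (n - 1)

/-- Gluing continuous functions along a finite chain of breakpoints. -/
theorem continuous_findGreatest_glue (f : ℕ → ℝ → ℝ) (a : ℕ → ℝ)
    [∀ x : ℝ, DecidablePred fun k => a k ≤ x] (N : ℕ) (hf : ∀ k, Continuous (f k))
    (ha : ∀ k < N, a k ≤ a (k + 1))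
    (hglue : ∀ k < N, f k (a (k + 1)) = f (k + 1) (a (k + 1))) :
    Continuous fun x => f (Nat.findGreatest (fun k => a k ≤ x) N) x := by
  induction N with
  | zero => simpa using hf 0
  | succ N ih =>
    have ih' := ih (fun k hk => ha k (by omega)) (fun k hk => hglue k (by omega))
    have h : (fun x => f (Nat.findGreatest (fun k => a k ≤ x) (N + 1)) x) =
        fun x => if a (N + 1) ≤ x then f (N + 1) x
          else f (Nat.findGreatest (fun k => a k ≤ x) N) x := by
      funext x
      rw [Nat.findGreatest_succ]
      split_ifs <;> rfl
    rw [h]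
    refine Continuous.if_le (hf _) ih' continuous_const continuous_id ?_
    rintro x rfl
    rw [Nat.findGreatest_eq (ha N (by omega)), hglue N (by omega)]

theorem wgt_continuous (n k : ℕ) (p : ℕ → ℝ) (i : ℕ) :
    Continuous fun α : ℝ => wgt n k p α i := by
  unfold wgt
  split_ifs <;> fun_prop

theorem sum_Icc_eq_add_last (p : ℕ → ℝ) {m : ℕ} (hm : 1 ≤ m) :
    ∑ i ∈ Finset.Icc 1 m, p i = ∑ i ∈ Finset.Icc 1 (m - 1), p i + p m := by
  obtain ⟨m, rfl⟩ := Nat.exists_eq_add_of_le' hm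
  exact Finset.sum_Icc_succ_top (by omega) p

theorem sum_Icc_add_sum_Icc (p : ℕ → ℝ) {m n : ℕ} (hm : 1 ≤ m) (hmn : m ≤ n) :
    ∑ i ∈ Finset.Icc 1 (m - 1), p i + ∑ i ∈ Finset.Icc m n, p i =
      ∑ i ∈ Finset.Icc 1 n, p i := by
  rw [← Finset.sum_union]
  · congr 1
    ext x
    simp only [Finset.mem_union, Finset.mem_Icc]
    omega
  · rw [Finset.disjoint_left]
    intro x
    simp only [Finset.mem_Icc]
    omega

theorem sum_Icc_nonneg_of_pos {n m : ℕ} {p : ℕ → ℝ} (hpos : ∀ i, 1 ≤ i → i ≤ n → 0 < p i)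
    (hm : m ≤ n) : 0 ≤ ∑ i ∈ Finset.Icc 1 m, p i :=
  Finset.sum_nonneg fun i hi => by
    rw [Finset.mem_Icc] at hi
    exact (hpos i hi.1 (hi.2.trans hm)).le

/-- The breakpoints in closed form. -/
theorem one_sub_alphaB_mul {n : ℕ} {p : ℕ → ℝ} (hpos : ∀ i, 1 ≤ i → i ≤ n → 0 < p i)
    (hsum : ∑ i ∈ Finset.Icc 1 n, p i = 1) {k : ℕ} (hk : k < n) :
    (1 - alphaB n p k) *
      (∑ i ∈ Finset.Icc 1 (n - k - 1), p i + ((k : ℝ) + 1) * p (n - k)) = 1 := by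
  induction k with
  | zero =>
    rw [sum_Icc_eq_add_last p (by omega)] at hsum
    simpa [alphaB] using hsum
  | succ k ih =>
    have ih' := ih (by omega)
    have hS := sum_Icc_nonneg_of_pos (m := n - k - 1) hpos (by omega)
    have hq := hpos (n - k - 1) (by omega) (by omega)
    have hsplit := sum_Icc_eq_add_last p (m := n - k - 1) (by omega)
    rw [alphaB, show n - (k + 1) = n - k - 1 by omega]
    rw [eq_sub_of_add_eq hsplit.symm]
    set S := ∑ i ∈ Finset.Icc 1 (n - k - 1), p i
    have hD : S + ((k : ℝ) + 1) * p (n - k - 1) ≠ 0 := by positivity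
    have hden : (1 / ((k : ℝ) + 1)) * S + p (n - k - 1) =
        (S + ((k : ℝ) + 1) * p (n - k - 1)) / ((k : ℝ) + 1) := by
      field_simp
    rw [hden]
    push_cast
    field_simp
    linear_combination (S + ((k : ℝ) + 1) * p (n - k - 1)) * ih'

theorem alphaB_le_succ {n : ℕ} {p : ℕ → ℝ} (hpos : ∀ i, 1 ≤ i → i ≤ n → 0 < p i)
    (hmono : ∀ i j, 1 ≤ i → i ≤ j → j ≤ n → p j ≤ p i)
    (hsum : ∑ i ∈ Finset.Icc 1 n, p i = 1) {k : ℕ} (hk : k + 1 < n) :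
    alphaB n p k ≤ alphaB n p (k + 1) := by
  have h := one_sub_alphaB_mul hpos hsum (k := k) (by omega)
  have hS := sum_Icc_nonneg_of_pos (m := n - k - 1) hpos (by omega)
  have hq := hpos (n - k - 1) (by omega) (by omega)
  have hr := hpos (n - k) (by omega) (by omega)
  have hqr := sub_nonneg.2 (hmono (n - k - 1) (n - k) (by omega) (by omega) (by omega))
  have h1 : 0 < 1 - alphaB n p k :=
    pos_of_mul_pos_left (h ▸ one_pos) (by positivity)
  rw [alphaB]
  exact le_add_of_nonneg_right (by positivity)

theorem wgt_alphaB_succ {n : ℕ} {p : ℕ → ℝ} (hpos : ∀ i, 1 ≤ i → i ≤ n → 0 < p i)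
    (hsum : ∑ i ∈ Finset.Icc 1 n, p i = 1) {k : ℕ} (hk : k + 1 < n) (i : ℕ) :
    wgt n k p (alphaB n p (k + 1)) i = wgt n (k + 1) p (alphaB n p (k + 1)) i := by
  have h := one_sub_alphaB_mul hpos hsum hk
  have hsplit := sum_Icc_eq_add_last p (m := n - k - 1) (by omega)
  have hT := sum_Icc_add_sum_Icc p (m := n - k) (n := n) (by omega) (by omega)
  have hT' := sum_Icc_add_sum_Icc p (m := n - k - 1) (n := n) (by omega) (by omega)
  rw [hsum] at hT hT'
  have hk1 : (k : ℝ) + 1 ≠ 0 := by positivity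
  have hk2 : (k : ℝ) + 1 + 1 ≠ 0 := by positivity
  unfold wgt
  rw [show n - (k + 1) = n - k - 1 by omega] at h ⊢
  rw [eq_sub_of_add_eq hsplit.symm] at h hT'
  rw [eq_sub_of_add_eq' hT, eq_sub_of_add_eq' hT']
  push_cast at h ⊢
  split_ifs with h₁ h₂ h₂
  · rfl
  · obtain rfl : i = n - k - 1 := by omega
    rw [eq_div_iff hk2]
    linear_combination h
  · omega
  · rw [div_eq_div_iff hk1 hk2]
    linear_combination -h

/-- For each `i ∈ {1,…,n}`, the map `α ↦ w_α(i)` (defined piecewise,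
on the interval `[α_k, α_{k+1})` by the formula for interval `k`) is continuous on
`[0,1]`; in particular, at each breakpoint `α_{k+1}` the piecewise-linear formulas
for the intervals `[α_k, α_{k+1})` and `[α_{k+1}, α_{k+2})` agree. -/
theorem weights_continuous_in_alpha
    (n : ℕ) (hn : 2 ≤ n) (p : ℕ → ℝ)
    (hpos : ∀ i, 1 ≤ i → i ≤ n → 0 < p i)
    (hmono : ∀ i j, 1 ≤ i → i ≤ j → j ≤ n → p j ≤ p i)
    (hsum : ∑ i ∈ Finset.Icc 1 n, p i = 1) :
    (∀ i, 1 ≤ i → i ≤ n →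
      ContinuousOn (fun α : ℝ => wgt n (kIdx n p α) p α i) (Set.Icc (0 : ℝ) 1)) ∧
    (∀ k, k ≤ n - 2 → ∀ i, 1 ≤ i → i ≤ n →
      wgt n k p (alphaB n p (k + 1)) i = wgt n (k + 1) p (alphaB n p (k + 1)) i) := by
  refine ⟨fun i _ _ => Continuous.continuousOn ?_,
    fun k hk i _ _ => wgt_alphaB_succ hpos hsum (by omega) i⟩
  unfold kIdx
  exact continuous_findGreatest_glue (fun k α => wgt n k p α i) (alphaB n p) (n - 1)
    (fun k => wgt_continuous n k p i)
    (fun k hk => alphaB_le_succ hpos hmono hsum (by omega))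
    (fun k hk => wgt_alphaB_succ hpos hsum (by omega) i)
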